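/- arXiv:0810.0994 — 2 statements merged into one kernel-verified Lean document; each statement's English description precedes it below -/
import Mathlib

section
/- Let V be a real vector space of dimension n ≥ 2 with a nondegenerate symmetric bilinear form g. Suppose symmetric bilinear forms a, A, λ, Λ (written with indices a_{ij}, A_{ij}, λ_{ij}, Λ_{ij}) and a (1,3)-tensor R^i_{jkl} having all the algebraic symmetries of a Riemann curvature tensor with respect to g satisfy a_{ip}R^p_{jkl} + a_{pj}R^p_{ikl} = λ_{li}g_{jk} + λ_{lj}g_{ik} − λ_{ki}g_{jl} − λ_{kj}g_{il} and A_{ip}R^p_{jkl} + A_{pj}R^p_{ikl} = Λ_{li}g_{jk} + Λ_{lj}g_{ik} − Λ_{ki}g_{jl} − Λ_{kj}g_{il}. If a, A, g are linearly independent, then λ is a linear combination of a and g. -/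
open scoped BigOperators

section BilinearForms

variable {V : Type*} [AddCommGroup V] [Module ℝ V]

/-- A linear functional vanishing on the kernel of another one is a multiple of it. -/
lemma exists_eq_smul_of_ker {φ α : V →ₗ[ℝ] ℝ} (h : ∀ y, φ y = 0 → α y = 0) :
    ∃ k : ℝ, α = k • φ := by
  by_cases hφ : ∃ f, φ f ≠ 0
  · obtain ⟨f, hf⟩ := hφ
    refine ⟨α f / φ f, LinearMap.ext fun y => ?_⟩
    have h0 := h (φ f • y - φ y • f) (by simp [mul_comm])
    simp only [map_sub, map_smul, smul_eq_mul, LinearMap.smul_apply] at h0 ⊢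
    field_simp
    linarith
  · push Not at hφ
    exact ⟨0, LinearMap.ext fun y => by simpa using h y (hφ y)⟩

/-- Unique factorization for products of two linear functionals. -/
lemma exists_smul_of_mul_eq_mul {φ ψ α β : V →ₗ[ℝ] ℝ}
    (hφ : φ ≠ 0) (hψ : ∀ c : ℝ, ψ ≠ c • φ) (h : ∀ y, α y * ψ y = β y * φ y) :
    ∃ k : ℝ, α = k • φ ∧ β = k • ψ := by
  obtain ⟨e, heφ, heψ⟩ : ∃ e, φ e = 0 ∧ ψ e ≠ 0 := by
    by_contra! hne
    obtain ⟨c, hc⟩ := exists_eq_smul_of_ker hne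
    exact hψ c hc
  have hker : ∀ y, φ y = 0 → α y = 0 := by
    intro y hy
    have he := h e
    have h1 := h y
    have h2 := h (y + e)
    simp only [map_add, heφ, hy, mul_zero, add_zero] at he h1 h2
    have he' : α e = 0 := (mul_eq_zero.mp he).resolve_right heψ
    have : α y * ψ e = 0 := by rw [he'] at h2; linarith
    exact (mul_eq_zero.mp this).resolve_right heψ
  obtain ⟨k, hk⟩ := exists_eq_smul_of_ker hker
  refine ⟨k, hk, LinearMap.ext fun y => ?_⟩
  obtain ⟨f, hf⟩ : ∃ f, φ f ≠ 0 := by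
    by_contra! hne
    exact hφ (LinearMap.ext hne)
  have key : ∀ y, φ y ≠ 0 → β y = k * ψ y := fun y hy => by
    have := h y
    rw [hk] at this
    simp only [LinearMap.smul_apply, smul_eq_mul] at this
    exact mul_right_cancel₀ hy (by linarith)
  rw [LinearMap.smul_apply, smul_eq_mul]
  by_cases hy : φ y = 0
  · have h1 := key (y + f) (by simpa [hy] using hf)
    have h2 := key f hf
    simp only [map_add] at h1
    linarith
  · exact key y hy

/-- A symmetric bilinear form all of whose values are multiples of one functional `φ ≠ 0`
is a multiple of `φ ⊗ φ`. -/
lemma exists_eq_mul_mul_of_symm {B : V →ₗ[ℝ] V →ₗ[ℝ] ℝ} (hB : ∀ x y, B x y = B y x)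
    {φ : V →ₗ[ℝ] ℝ} (hφ : φ ≠ 0) (h : ∀ x, ∃ k : ℝ, B x = k • φ) :
    ∃ c : ℝ, ∀ x y, B x y = c * φ x * φ y := by
  obtain ⟨f, hf⟩ : ∃ f, φ f ≠ 0 := by
    by_contra! hne
    exact hφ (LinearMap.ext hne)
  choose k hk using h
  refine ⟨k f / φ f, fun x y => ?_⟩
  have h1 := hB x f
  simp only [hk, LinearMap.smul_apply, smul_eq_mul] at h1 ⊢
  field_simp
  linear_combination φ y * h1

/-- Linearly independent symmetric bilinear forms take linearly independent values at some
vector. -/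
lemma exists_apply_not_smul {a A : V →ₗ[ℝ] V →ₗ[ℝ] ℝ}
    (ha : ∀ x y, a x y = a y x) (hA : ∀ x y, A x y = A y x)
    (ha0 : a ≠ 0) (hAa : ∀ c : ℝ, A ≠ c • a) :
    ∃ x, a x ≠ 0 ∧ ∀ c : ℝ, A x ≠ c • a x := by
  by_contra! hne
  obtain ⟨x, hx⟩ : ∃ x, a x ≠ 0 := by
    by_contra! h
    exact ha0 (LinearMap.ext h)
  obtain ⟨f, hf⟩ : ∃ f, a x f ≠ 0 := by
    by_contra! h
    exact hx (LinearMap.ext h)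
  obtain ⟨c, hc⟩ := hne x hx
  obtain ⟨B, hBdef⟩ : ∃ B, B = A - c • a := ⟨_, rfl⟩
  have hBx : B x = 0 := by simp [hBdef, hc]
  have hB : ∀ x y, B x y = B y x := fun x y => by simp [hBdef, ha x y, hA x y]
  have hdep : ∀ z, a z ≠ 0 → ∃ k : ℝ, B z = k • a z := fun z hz => by
    obtain ⟨k, hk⟩ := hne z hz
    exact ⟨k - c, LinearMap.ext fun v => by simp [hBdef, hk, sub_mul]⟩
  have hminor : ∀ z u v, a z u * B z v = a z v * B z u := fun z u v => by
    by_cases hz : a z = 0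
    · simp [hz]
    · obtain ⟨k, hk⟩ := hdep z hz
      simp only [hk, LinearMap.smul_apply, smul_eq_mul]
      ring
  have hBz : ∀ z, ∃ k : ℝ, B z = k • a x := fun z => by
    refine exists_eq_smul_of_ker fun v hv => ?_
    have h1 := hminor z f v
    have h2 := hminor (z + x) f v
    simp only [map_add, LinearMap.add_apply, hBx, hv, add_zero] at h2
    exact (mul_eq_zero.mp (show a x f * B z v = 0 by linarith)).resolve_left hf
  obtain ⟨m, hm⟩ := exists_eq_mul_mul_of_symm hB hx hBz
  have hm0 : m ≠ 0 := by
    rintro rfl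
    refine hAa c (sub_eq_zero.mp ?_)
    rw [← hBdef]
    ext u v
    simp [hm]
  have hgen : ∀ z, a x z ≠ 0 → ∀ v, a x v = 0 → a z v = 0 := fun z hz v hv => by
    have h1 := hminor z f v
    simp only [hm, hv, mul_zero] at h1
    have : m * a x z * a x f ≠ 0 := mul_ne_zero (mul_ne_zero hm0 hz) hf
    exact (mul_eq_zero.mp h1.symm).resolve_right this
  have haz : ∀ z, ∃ k : ℝ, a z = k • a x := fun z => by
    refine exists_eq_smul_of_ker fun v hv => ?_
    by_cases hz : a x z = 0
    · have h1 := hgen (z + f) (by simpa [hz] using hf) v hv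
      have h2 := hgen f hf v hv
      simpa [h2] using h1
    · exact hgen z hz v hv
  obtain ⟨r, hr⟩ := exists_eq_mul_mul_of_symm ha hx haz
  have hr0 : r ≠ 0 := by
    rintro rfl
    exact hf (by simpa using hr x f)
  refine hAa (c + m / r) ?_
  have hA' : A = B + c • a := by ext; simp [hBdef]
  rw [hA', add_smul, add_comm]
  congr 1
  ext u v
  simp only [LinearMap.smul_apply, smul_eq_mul]
  rw [hm u v, hr u v]
  field_simp

/-- If `lam * A = Lam * a` as functions of two vectors, where all forms are symmetric and
`a, A` are linearly independent, then `lam` is a multiple of `a`. -/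
lemma exists_smul_of_bilin_mul_eq_mul {a A lam Lam : V →ₗ[ℝ] V →ₗ[ℝ] ℝ}
    (ha : ∀ x y, a x y = a y x) (hA : ∀ x y, A x y = A y x)
    (hlam : ∀ x y, lam x y = lam y x) (hLam : ∀ x y, Lam x y = Lam y x)
    (ha0 : a ≠ 0) (hAa : ∀ c : ℝ, A ≠ c • a)
    (h : ∀ x y, lam x y * A x y = Lam x y * a x y) :
    ∃ s : ℝ, lam = s • a := by
  obtain ⟨x, hx, hxA⟩ := exists_apply_not_smul ha hA ha0 hAa
  obtain ⟨s, hs, hS⟩ := exists_smul_of_mul_eq_mul hx hxA (h x)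
  obtain ⟨l, hl⟩ : ∃ l, l = lam - s • a := ⟨_, rfl⟩
  obtain ⟨L, hL⟩ : ∃ L, L = Lam - s • A := ⟨_, rfl⟩
  have hlx : l x = 0 := by simp [hl, hs]
  have hLx : L x = 0 := by simp [hL, hS]
  have hlsymm : ∀ x y, l x y = l y x := fun x y => by simp [hl, ha x y, hlam x y]
  have hLsymm : ∀ x y, L x y = L y x := fun x y => by simp [hL, hA x y, hLam x y]
  have hmul : ∀ x y, l x y * A x y = L x y * a x y := fun x y => by
    simp only [hl, hL, LinearMap.sub_apply, LinearMap.smul_apply, smul_eq_mul]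
    linear_combination h x y
  have hz : ∀ z, ∃ k : ℝ, l z = k • a x ∧ L z = k • A x := fun z => by
    refine exists_smul_of_mul_eq_mul hx hxA fun y => ?_
    have h1 := hmul z y
    have h2 := hmul (z + x) y
    simp only [map_add, LinearMap.add_apply, hlx, hLx, add_zero] at h2
    linarith
  choose k hk hK using hz
  have hk0 : ∀ z, k z = 0 := by
    by_contra! hne
    obtain ⟨z, hz⟩ := hne
    have e1 : ∀ v, k z * a x v = k v * a x z := fun v => by
      simpa [hk] using hlsymm z v
    have e2 : ∀ v, k z * A x v = k v * A x z := fun v => by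
      simpa [hK] using hLsymm z v
    have hz' : a x z ≠ 0 := fun h0 => hx (LinearMap.ext fun v => by
      simpa [h0, hz] using e1 v)
    refine hxA (A x z / a x z) (LinearMap.ext fun v => ?_)
    simp only [LinearMap.smul_apply, smul_eq_mul]
    field_simp
    refine mul_left_cancel₀ hz ?_
    linear_combination a x z * e2 v - A x z * e1 v
  refine ⟨s, sub_eq_zero.mp ?_⟩
  rw [← hl]
  ext z v
  simp [hk, hk0]

end BilinearForms

section Matrices

open Matrix

variable {ι : Type*} [Fintype ι]

lemma sum_sum_mul_mul (u v y : ι → ℝ) :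
    ∑ k, ∑ l, y k * y l * (u k * v l) = (u ⬝ᵥ y) * (v ⬝ᵥ y) := by
  simp only [dotProduct, Finset.sum_mul_sum]
  exact Finset.sum_congr rfl fun k _ => Finset.sum_congr rfl fun l _ => by ring

/-- Polarized equality of products of symmetric matrices implies equality of the products of
the associated bilinear forms. -/
lemma toLinearMap₂'_mul_eq_mul [DecidableEq ι] {a A lam Lam : Matrix ι ι ℝ}
    (h : ∀ i j k l, lam i k * A j l + lam i l * A j k + lam j k * A i l + lam j l * A i k
      = Lam i k * a j l + Lam i l * a j k + Lam j k * a i l + Lam j l * a i k)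
    (x y : ι → ℝ) :
    toLinearMap₂' ℝ lam x y * toLinearMap₂' ℝ A x y
      = toLinearMap₂' ℝ Lam x y * toLinearMap₂' ℝ a x y := by
  have hy : ∀ i j, (lam *ᵥ y) i * (A *ᵥ y) j + (lam *ᵥ y) j * (A *ᵥ y) i
      = (Lam *ᵥ y) i * (a *ᵥ y) j + (Lam *ᵥ y) j * (a *ᵥ y) i := by
    intro i j
    have h1 : ∑ k, ∑ l, y k * y l *
        (lam i k * A j l + A j k * lam i l + lam j k * A i l + A i k * lam j l)
        = ∑ k, ∑ l, y k * y l *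
        (Lam i k * a j l + a j k * Lam i l + Lam j k * a i l + a i k * Lam j l) :=
      Finset.sum_congr rfl fun k _ => Finset.sum_congr rfl fun l _ => by
        linear_combination y k * y l * h i j k l
    simp only [mul_add, Finset.sum_add_distrib] at h1
    simp only [sum_sum_mul_mul] at h1
    simp only [mulVec]
    linarith
  have h2 : ∑ i, ∑ j, x i * x j *
      ((lam *ᵥ y) i * (A *ᵥ y) j + (A *ᵥ y) i * (lam *ᵥ y) j)
      = ∑ i, ∑ j, x i * x j *
      ((Lam *ᵥ y) i * (a *ᵥ y) j + (a *ᵥ y) i * (Lam *ᵥ y) j) :=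
    Finset.sum_congr rfl fun i _ => Finset.sum_congr rfl fun j _ => by
      linear_combination x i * x j * hy i j
  simp only [mul_add, Finset.sum_add_distrib] at h2
  simp only [sum_sum_mul_mul] at h2
  simp only [toLinearMap₂'_apply', dotProduct_comm x]
  linarith

lemma toLinearMap₂'_symm [DecidableEq ι] {a : Matrix ι ι ℝ} (ha : aᵀ = a) (x y : ι → ℝ) :
    toLinearMap₂' ℝ a x y = toLinearMap₂' ℝ a y x := by
  rw [toLinearMap₂'_apply', toLinearMap₂'_apply', dotProduct_comm, ← vecMul_transpose, ha,
    ← dotProduct_mulVec]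

lemma exists_smul_of_matrix_mul_eq_mul [DecidableEq ι] {a A lam Lam : Matrix ι ι ℝ}
    (ha : aᵀ = a) (hA : Aᵀ = A) (hlam : lamᵀ = lam) (hLam : Lamᵀ = Lam)
    (ha0 : a ≠ 0) (hAa : ∀ c : ℝ, A ≠ c • a)
    (h : ∀ i j k l, lam i k * A j l + lam i l * A j k + lam j k * A i l + lam j l * A i k
      = Lam i k * a j l + Lam i l * a j k + Lam j k * a i l + Lam j l * a i k) :
    ∃ s : ℝ, lam = s • a := by
  obtain ⟨s, hs⟩ := exists_smul_of_bilin_mul_eq_mul (toLinearMap₂'_symm ha)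
    (toLinearMap₂'_symm hA) (toLinearMap₂'_symm hlam) (toLinearMap₂'_symm hLam)
    (fun h0 => ha0 ((toLinearMap₂' ℝ).injective (h0.trans (map_zero _).symm)))
    (fun c hc => hAa c ((toLinearMap₂' ℝ).injective (by rw [hc, map_smul])))
    (toLinearMap₂'_mul_eq_mul h)
  exact ⟨s, (toLinearMap₂' ℝ).injective (by rw [hs, map_smul])⟩

/-- Contraction of the two integrability conditions. The products of matrices are taken with
the index raised by `G = g⁻¹`. -/
lemma contracted_integrability [DecidableEq ι] {g G a A lam Lam : Matrix ι ι ℝ}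
    {Q : ι → ι → ι → ι → ℝ} (hG : G * g = 1) (hg : gᵀ = g)
    (hA : Aᵀ = A) (hlam : lamᵀ = lam)
    (hQ1 : ∀ i j k l, Q i j k l = - Q j i k l)
    (hQ3 : ∀ i j k l, Q i j k l = Q k l i j)
    (h1 : ∀ i j k l, (∑ p, (a * G) i p * Q p j k l) + (∑ p, (a * G) j p * Q p i k l)
      = lam l i * g j k + lam l j * g i k - lam k i * g j l - lam k j * g i l)
    (h2 : ∀ i j k l, (∑ p, (A * G) i p * Q p j k l) + (∑ p, (A * G) j p * Q p i k l)
      = Lam l i * g j k + Lam l j * g i k - Lam k i * g j l - Lam k j * g i l)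
    {τ : Matrix ι ι ℝ} (hτ : τ = (A * G * lam)ᵀ - a * G * Lam) (i j k l : ι) :
    τ i l * g j k + τ i k * g j l + τ j l * g i k + τ j k * g i l
      = (lam i k * A j l + lam i l * A j k + lam j k * A i l + lam j l * A i k)
        - (Lam i k * a j l + Lam i l * a j k + Lam j k * a i l + Lam j l * a i k) := by
  have sg : ∀ i j, g i j = g j i := fun i j => congrFun₂ hg j i
  have sA : ∀ i j, A i j = A j i := fun i j => congrFun₂ hA j i
  have sl : ∀ i j, lam i j = lam j i := fun i j => congrFun₂ hlam j i
  have hb : a * G * g = a := by rw [mul_assoc, hG, mul_one]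
  have hB : A * G * g = A := by rw [mul_assoc, hG, mul_one]
  generalize a * G = b at *
  generalize A * G = B at *
  let T : ι → ι → ι → ι → ℝ := fun i j k l => ∑ q, B l q * ∑ p, b i p * Q p j k q
  have hT1 : ∀ i j k l, T i j k l + T j i k l
      = (B * lam) l i * g j k + (B * lam) l j * g i k - lam k i * A l j - lam k j * A l i := by
    intro i j k l
    simp only [T, ← Finset.sum_add_distrib, ← mul_add, h1]
    rw [← hB]
    simp only [mul_apply, Finset.sum_mul, Finset.mul_sum, ← Finset.sum_add_distrib,
      ← Finset.sum_sub_distrib]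
    refine Finset.sum_congr rfl fun q _ => ?_
    rw [sg q j, sg q i]
    ring
  have hT2 : ∀ i j k l, T i j k l + T i j l k
      = (b * Lam) i l * g k j + (b * Lam) i k * g l j - Lam j l * a i k - Lam j k * a i l := by
    intro i j k l
    have hT : ∀ k l, T i j k l = - ∑ p, b i p * ∑ q, B l q * Q q k p j := fun k l => by
      simp only [T, Finset.mul_sum]
      rw [Finset.sum_comm, ← Finset.sum_neg_distrib]
      refine Finset.sum_congr rfl fun p _ => ?_
      rw [← Finset.sum_neg_distrib]
      refine Finset.sum_congr rfl fun q _ => ?_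
      rw [hQ3 p j k q, hQ1 k q p j]
      ring
    rw [hT, hT, ← neg_add]
    simp only [← Finset.sum_add_distrib, ← mul_add, h2]
    rw [← hb]
    simp only [mul_apply, Finset.sum_mul, Finset.mul_sum, ← Finset.sum_add_distrib,
      ← Finset.sum_sub_distrib, ← Finset.sum_neg_distrib]
    refine Finset.sum_congr rfl fun q _ => ?_
    rw [sg q k, sg q l]
    ring
  have e1 := hT1 i j k l
  have e2 := hT1 i j l k
  have e3 := hT2 i j k l
  have e4 := hT2 j i k l
  simp only [hτ, Matrix.sub_apply, transpose_apply]
  rw [sg k j, sg l j] at e3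
  rw [sg k i, sg l i] at e4
  rw [sA l j, sA l i, sl k i, sl k j] at e1
  rw [sA k j, sA k i, sl l i, sl l j] at e2
  linear_combination e3 + e4 - e1 - e2

/-- The contracted condition has no `g`-part as soon as all forms are trace-free. -/
lemma contracted_defect_eq_zero [DecidableEq ι] [Nonempty ι] {g G a A lam Lam : Matrix ι ι ℝ}
    (hG : G * g = 1) (hg : gᵀ = g)
    (ha : aᵀ = a) (hA : Aᵀ = A) (hlam : lamᵀ = lam) (hLam : Lamᵀ = Lam)
    (ta : (G * a).trace = 0) (tA : (G * A).trace = 0)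
    (tlam : (G * lam).trace = 0) (tLam : (G * Lam).trace = 0)
    {τ : Matrix ι ι ℝ} (hτ : τ = (A * G * lam)ᵀ - a * G * Lam)
    (h : ∀ i j k l, τ i l * g j k + τ i k * g j l + τ j l * g i k + τ j k * g i l
      = (lam i k * A j l + lam i l * A j k + lam j k * A i l + lam j l * A i k)
        - (Lam i k * a j l + Lam i l * a j k + Lam j k * a i l + Lam j l * a i k)) :
    τ = 0 := by
  have hG' : g * G = 1 := mul_eq_one_comm.mp hG
  have hGt : Gᵀ = G := by
    have h1 : g * Gᵀ = 1 := by
      simpa [transpose_mul, hg] using congrArg transpose hG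
    calc Gᵀ = G * g * Gᵀ := by rw [hG, one_mul]
      _ = G := by rw [mul_assoc, h1, mul_one]
  have contr : ∀ (X Y : Matrix ι ι ℝ) (i l : ι),
      ∑ k, ∑ j, G k j * (X i l * Y j k + X i k * Y j l + X j l * Y i k + X j k * Y i l)
      = (G * Y).trace * X i l + (X * G * Y) i l + (Y * G * X) i l + (G * X).trace * Y i l := by
    intro X Y i l
    simp only [mul_assoc X G Y, mul_assoc Y G X]
    simp only [trace, diag_apply, mul_apply, Finset.sum_mul, Finset.mul_sum,
      ← Finset.sum_add_distrib]
    exact Finset.sum_congr rfl fun k _ => Finset.sum_congr rfl fun j _ => by ring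
  have hτ1 : τ = lam * G * A - a * G * Lam := by
    rw [hτ, transpose_mul, transpose_mul, hA, hlam, hGt, mul_assoc lam]
  have hτ2 : τᵀ = A * G * lam - Lam * G * a := by
    rw [hτ, transpose_sub, transpose_transpose, transpose_mul, transpose_mul, ha, hLam, hGt,
      mul_assoc Lam]
  have key : ∀ i l, ((Fintype.card ι : ℝ) + 2) * τ i l + (G * τ).trace * g i l
      = τ i l + τ l i := by
    intro i l
    have e1 := contr τ g i l
    have e2 := contr lam A i l
    have e3 := contr Lam a i l
    have e : ∑ k, ∑ j, G k j * (τ i l * g j k + τ i k * g j l + τ j l * g i k + τ j k * g i l)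
        = ∑ k, ∑ j, G k j * (lam i l * A j k + lam i k * A j l + lam j l * A i k
          + lam j k * A i l) - ∑ k, ∑ j, G k j * (Lam i l * a j k + Lam i k * a j l
          + Lam j l * a i k + Lam j k * a i l) := by
      simp only [← Finset.sum_sub_distrib]
      exact Finset.sum_congr rfl fun k _ => Finset.sum_congr rfl fun j _ => by
        linear_combination G k j * h i j k l
    rw [e1, e2, e3, ta, tA, tlam, tLam, hG, mul_assoc τ, hG, mul_one, hG', one_mul,
      trace_one] at e
    have t1 := congrFun₂ hτ1 i l
    have t2 := congrFun₂ hτ2 i l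
    simp only [Matrix.sub_apply, transpose_apply] at t1 t2
    linear_combination e - t1 - t2
  have hn : (0 : ℝ) < Fintype.card ι := by exact_mod_cast Fintype.card_pos
  have hsymm : ∀ i l, τ l i = τ i l := fun i l => by
    have h1 := key i l
    have h2 := key l i
    rw [show g l i = g i l from congrFun₂ hg i l] at h2
    have h3 : ((Fintype.card ι : ℝ) + 2) * (τ l i - τ i l) = 0 := by linear_combination h2 - h1
    exact sub_eq_zero.mp ((mul_eq_zero.mp h3).resolve_left (by positivity))
  have hmat : (Fintype.card ι : ℝ) • τ = -(G * τ).trace • g := by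
    ext i l
    have h1 := key i l
    rw [hsymm i l] at h1
    simp only [Matrix.smul_apply, smul_eq_mul]
    linear_combination h1
  have htr : (G * τ).trace = 0 := by
    have h1 := congrArg (fun M => (G * M).trace) hmat
    simp only [Matrix.mul_smul, trace_smul, smul_eq_mul, hG, trace_one] at h1
    have h2 : (Fintype.card ι : ℝ) * (G * τ).trace = 0 := by linarith
    exact (mul_eq_zero.mp h2).resolve_left hn.ne'
  rw [htr, neg_zero, zero_smul] at hmat
  exact (smul_eq_zero.mp hmat).resolve_left hn.ne'

/-- The lemma for trace-free forms. -/
lemma exists_smul_of_trace_free [DecidableEq ι] [Nonempty ι] {g G a A lam Lam : Matrix ι ι ℝ}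
    {Q : ι → ι → ι → ι → ℝ} (hG : G * g = 1) (hg : gᵀ = g)
    (ha : aᵀ = a) (hA : Aᵀ = A) (hlam : lamᵀ = lam) (hLam : Lamᵀ = Lam)
    (ta : (G * a).trace = 0) (tA : (G * A).trace = 0)
    (tlam : (G * lam).trace = 0) (tLam : (G * Lam).trace = 0)
    (ha0 : a ≠ 0) (hAa : ∀ c : ℝ, A ≠ c • a)
    (hQ1 : ∀ i j k l, Q i j k l = - Q j i k l)
    (hQ3 : ∀ i j k l, Q i j k l = Q k l i j)
    (h1 : ∀ i j k l, (∑ p, (a * G) i p * Q p j k l) + (∑ p, (a * G) j p * Q p i k l)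
      = lam l i * g j k + lam l j * g i k - lam k i * g j l - lam k j * g i l)
    (h2 : ∀ i j k l, (∑ p, (A * G) i p * Q p j k l) + (∑ p, (A * G) j p * Q p i k l)
      = Lam l i * g j k + Lam l j * g i k - Lam k i * g j l - Lam k j * g i l) :
    ∃ s : ℝ, lam = s • a := by
  have h := contracted_integrability hG hg hA hlam hQ1 hQ3 h1 h2 rfl
  have hτ := contracted_defect_eq_zero hG hg ha hA hlam hLam ta tA tlam tLam rfl h
  refine exists_smul_of_matrix_mul_eq_mul ha hA hlam hLam ha0 hAa fun i j k l => ?_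
  have := h i j k l
  simp only [hτ, Matrix.zero_apply, zero_mul, add_zero] at this
  linarith

/-- The integrability condition is insensitive to adding multiples of `g` to both forms. -/
lemma integrability_sub_smul [DecidableEq ι] {g G a lam : Matrix ι ι ℝ}
    {R Q : ι → ι → ι → ι → ℝ} (hG : G * g = 1) (hg : gᵀ = g) (ha : aᵀ = a)
    (hQ : ∀ i j k l, Q i j k l = ∑ p, g i p * R p j k l)
    (hQ1 : ∀ i j k l, Q i j k l = - Q j i k l)
    (h : ∀ i j k l, (∑ p, a i p * R p j k l) + (∑ p, a p j * R p i k l)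
      = lam l i * g j k + lam l j * g i k - lam k i * g j l - lam k j * g i l)
    (c d : ℝ) (i j k l : ι) :
    (∑ p, ((a - c • g) * G) i p * Q p j k l) + (∑ p, ((a - c • g) * G) j p * Q p i k l)
      = (lam - d • g) l i * g j k + (lam - d • g) l j * g i k
        - (lam - d • g) k i * g j l - (lam - d • g) k j * g i l := by
  have sg : ∀ i j, g i j = g j i := fun i j => congrFun₂ hg j i
  have hraise : ∀ i j, ∑ p, ((a - c • g) * G) i p * Q p j k l
      = ∑ p, a i p * R p j k l - c * Q i j k l := fun i j => by
    have h1 : (((a - c • g) * G) * g) *ᵥ (fun p => R p j k l)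
        = (a - c • g) *ᵥ fun p => R p j k l := by rw [mul_assoc, hG, mul_one]
    rw [← mulVec_mulVec] at h1
    have h2 : g *ᵥ (fun p => R p j k l) = fun p => Q p j k l :=
      funext fun p => (hQ p j k l).symm
    have h3 := congrFun h1 i
    rw [h2] at h3
    refine h3.trans ?_
    rw [sub_mulVec, smul_mulVec, h2]
    rfl
  have hj : ∑ p, a j p * R p i k l = ∑ p, a p j * R p i k l :=
    Finset.sum_congr rfl fun p _ => by rw [show a j p = a p j from congrFun₂ ha p j]
  rw [hraise, hraise, hj]
  simp only [Matrix.sub_apply, Matrix.smul_apply, smul_eq_mul]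
  rw [sg l i, sg l j, sg k i, sg k j]
  linear_combination h i j k l - c * hQ1 i j k l

lemma trace_mul_sub_smul [DecidableEq ι] [Nonempty ι] {g G : Matrix ι ι ℝ} (hG : G * g = 1)
    (X : Matrix ι ι ℝ) :
    (G * (X - ((G * X).trace / Fintype.card ι) • g)).trace = 0 := by
  have hn : (Fintype.card ι : ℝ) ≠ 0 := by exact_mod_cast Fintype.card_ne_zero
  rw [mul_sub, Matrix.mul_smul, hG, trace_sub, trace_smul, trace_one, smul_eq_mul,
    div_mul_cancel₀ _ hn, sub_self]

end Matrices

/-- Purely algebraic Lemma (Lemma 1 of the paper): if two symmetric forms `a`, `A`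
satisfy the integrability-type identities with respect to a nondegenerate symmetric
bilinear form `g` and a tensor `R` with the algebraic symmetries of a curvature
tensor, and `a, A, g` are linearly independent, then `lam` is a linear combination
of `a` and `g`. -/
theorem stmt_0 {n : ℕ} (hn : 2 ≤ n)
    (g a A lam Lam : Matrix (Fin n) (Fin n) ℝ)
    (R : Fin n → Fin n → Fin n → Fin n → ℝ)
    (hgsym : ∀ i j, g i j = g j i)
    (hgnd : g.det ≠ 0)
    (hasym : ∀ i j, a i j = a j i) (hAsym : ∀ i j, A i j = A j i)
    (hlsym : ∀ i j, lam i j = lam j i) (hLsym : ∀ i j, Lam i j = Lam j i)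
    -- `Rl` is the tensor `R` with the first index lowered by `g`
    (Rl : Fin n → Fin n → Fin n → Fin n → ℝ)
    (hRl : ∀ i j k l, Rl i j k l = ∑ p, g i p * R p j k l)
    -- algebraic symmetries of a curvature tensor
    (hR1 : ∀ i j k l, Rl i j k l = - Rl j i k l)
    (hR2 : ∀ i j k l, Rl i j k l = - Rl i j l k)
    (hR3 : ∀ i j k l, Rl i j k l = Rl k l i j)
    (hBianchi : ∀ p i k l, R p i k l + R p k l i + R p l i k = 0)
    -- the two integrability identities
    (heq1 : ∀ i j k l, (∑ p, a i p * R p j k l) + (∑ p, a p j * R p i k l)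
      = lam l i * g j k + lam l j * g i k - lam k i * g j l - lam k j * g i l)
    (heq2 : ∀ i j k l, (∑ p, A i p * R p j k l) + (∑ p, A p j * R p i k l)
      = Lam l i * g j k + Lam l j * g i k - Lam k i * g j l - Lam k j * g i l)
    (hli : LinearIndependent ℝ ![a, A, g]) :
    ∃ s t : ℝ, ∀ i j, lam i j = s * a i j + t * g i j := by
  have : Nonempty (Fin n) := ⟨⟨0, by omega⟩⟩
  have hG : g⁻¹ * g = 1 := Matrix.nonsing_inv_mul g (isUnit_iff_ne_zero.mpr hgnd)
  have transpose_eq : ∀ {X : Matrix (Fin n) (Fin n) ℝ}, (∀ i j, X i j = X j i) →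
      X.transpose = X := fun h => Matrix.ext fun i j => h j i
  have hg := transpose_eq hgsym
  have hsub : ∀ {X : Matrix (Fin n) (Fin n) ℝ}, (∀ i j, X i j = X j i) → ∀ c : ℝ,
      (X - c • g).transpose = X - c • g := fun h c => by
    rw [Matrix.transpose_sub, Matrix.transpose_smul, transpose_eq h, hg]
  let tr : Matrix (Fin n) (Fin n) ℝ → ℝ := fun X => (g⁻¹ * X).trace / Fintype.card (Fin n)
  have hcomb : ∀ u v w : ℝ, u • a + v • A + w • g = 0 → u = 0 ∧ v = 0 ∧ w = 0 := by
    intro u v w h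
    have h' := Fintype.linearIndependent_iff.mp hli ![u, v, w]
      (by simpa [Fin.sum_univ_three] using h)
    exact ⟨h' 0, h' 1, h' 2⟩
  obtain ⟨s, hs⟩ := exists_smul_of_trace_free hG hg
    (hsub hasym (tr a)) (hsub hAsym (tr A)) (hsub hlsym (tr lam)) (hsub hLsym (tr Lam))
    (trace_mul_sub_smul hG a) (trace_mul_sub_smul hG A)
    (trace_mul_sub_smul hG lam) (trace_mul_sub_smul hG Lam)
    (fun h0 => one_ne_zero (hcomb 1 0 (-tr a) (by rw [← h0]; module)).1)
    (fun c hc => one_ne_zero (hcomb (-c) 1 (c * tr a - tr A) (by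
      rw [← sub_eq_zero] at hc
      rw [← hc]
      module)).2.1)
    hR1 hR3
    (integrability_sub_smul hG hg (transpose_eq hasym) hRl hR1 heq1 (tr a) (tr lam))
    (integrability_sub_smul hG hg (transpose_eq hAsym) hRl hR1 heq2 (tr A) (tr Lam))
  refine ⟨s, tr lam - s * tr a, fun i j => ?_⟩
  have hij := congrFun₂ hs i j
  simp only [Matrix.sub_apply, Matrix.smul_apply, smul_eq_mul] at hij
  linear_combination hij
end

section
/- Let (a_{ij}, λ_i) satisfy a_{ij,k} = λ_i g_{jk} + λ_j g_{ik} and λ_{,ij} = μ g_{ij} + B a_{ij} on a neighborhood U of a pseudo-Riemannian manifold, with B a constant and μ a smooth function, and assume a is not a constant multiple of g (so that μ_{,i} = 2Bλ_i). Then λ satisfies f := λ obeys λ_{,ijk} − B(2λ_{,k}g_{ij} + λ_{,j}g_{ik} + λ_{,i}g_{jk}) = 0 on U. -/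
open scoped BigOperators
noncomputable section

/-- Partial derivative of a scalar function on ℝⁿ in direction `i`. -/
def pd {n : ℕ} (i : Fin n) (f : (Fin n → ℝ) → ℝ) (x : Fin n → ℝ) : ℝ :=
  fderiv ℝ f x (Pi.single i 1)

/-- Christoffel symbols `Γ^k_{ij}` of the Levi-Civita connection of the metric `g`
(`ginv` denotes the inverse metric). -/
def christoffel {n : ℕ} (g ginv : (Fin n → ℝ) → Fin n → Fin n → ℝ)
    (k i j : Fin n) (x : Fin n → ℝ) : ℝ :=
  (1/2) * ∑ l, ginv x k l *
    (pd i (fun y => g y l j) x + pd j (fun y => g y l i) x - pd l (fun y => g y i j) x)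

/-- Covariant derivative `ω_{i,j}` of a covector field `ω`. -/
def covD1 {n : ℕ} (g ginv : (Fin n → ℝ) → Fin n → Fin n → ℝ)
    (ω : (Fin n → ℝ) → Fin n → ℝ) (i j : Fin n) (x : Fin n → ℝ) : ℝ :=
  pd j (fun y => ω y i) x - ∑ p, christoffel g ginv p i j x * ω x p

/-- Covariant derivative `a_{ij,k}` of a symmetric (0,2)-tensor field `a`. -/
def covD2 {n : ℕ} (g ginv : (Fin n → ℝ) → Fin n → Fin n → ℝ)
    (a : (Fin n → ℝ) → Fin n → Fin n → ℝ) (i j k : Fin n) (x : Fin n → ℝ) : ℝ :=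
  pd k (fun y => a y i j) x - (∑ p, christoffel g ginv p i k x * a x p j)
    - ∑ p, christoffel g ginv p j k x * a x i p

/-- Hessian `f_{,ij}` of a function. -/
def hess {n : ℕ} (g ginv : (Fin n → ℝ) → Fin n → Fin n → ℝ)
    (f : (Fin n → ℝ) → ℝ) (i j : Fin n) (x : Fin n → ℝ) : ℝ :=
  covD1 g ginv (fun y p => pd p f y) i j x

/-- Third covariant derivative `f_{,ijk}` of a function. -/
def thirdD {n : ℕ} (g ginv : (Fin n → ℝ) → Fin n → Fin n → ℝ)
    (f : (Fin n → ℝ) → ℝ) (i j k : Fin n) (x : Fin n → ℝ) : ℝ :=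
  covD2 g ginv (fun y p q => hess g ginv f p q y) i j k x

open scoped ContDiff Matrix

section PartialDerivatives

variable {n : ℕ}

theorem ContDiff.pd {f : (Fin n → ℝ) → ℝ} (hf : ContDiff ℝ ∞ f) (k : Fin n) :
    ContDiff ℝ ∞ (pd k f) :=
  (hf.fderiv_right (m := ∞) (by simp)).clm_apply contDiff_const

theorem pd_add (k : Fin n) {f h : (Fin n → ℝ) → ℝ} (hf : ContDiff ℝ ∞ f)
    (hh : ContDiff ℝ ∞ h) (x : Fin n → ℝ) :
    pd k (fun y => f y + h y) x = pd k f x + pd k h x := by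
  have := fderiv_fun_add (hf.differentiable (by simp) x) (hh.differentiable (by simp) x)
  simp [pd, this]

theorem pd_mul (k : Fin n) {f h : (Fin n → ℝ) → ℝ} (hf : ContDiff ℝ ∞ f)
    (hh : ContDiff ℝ ∞ h) (x : Fin n → ℝ) :
    pd k (fun y => f y * h y) x = pd k f x * h x + f x * pd k h x := by
  have := fderiv_fun_mul (hf.differentiable (by simp) x) (hh.differentiable (by simp) x)
  simp [pd, this]
  ring

theorem pd_const_mul (k : Fin n) (c : ℝ) {f : (Fin n → ℝ) → ℝ} (hf : ContDiff ℝ ∞ f)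
    (x : Fin n → ℝ) : pd k (fun y => c * f y) x = c * pd k f x := by
  have := fderiv_const_mul (hf.differentiable (by simp) x) c
  simp [pd, this]

theorem pd_sum (k : Fin n) {ι : Type*} (s : Finset ι) {f : ι → (Fin n → ℝ) → ℝ}
    (hf : ∀ i, ContDiff ℝ ∞ (f i)) (x : Fin n → ℝ) :
    pd k (fun y => ∑ i ∈ s, f i y) x = ∑ i ∈ s, pd k (f i) x := by
  have := fderiv_fun_sum (u := s) fun i _ => (hf i).differentiable (by simp) x
  simp [pd, this]

theorem pd_comm (k l : Fin n) {f : (Fin n → ℝ) → ℝ} (hf : ContDiff ℝ ∞ f)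
    (x : Fin n → ℝ) : pd l (pd k f) x = pd k (pd l f) x := by
  have hd : DifferentiableAt ℝ (fderiv ℝ f) x :=
    (hf.fderiv_right (m := ∞) (by simp)).differentiable (by simp) x
  have key (v w : Fin n → ℝ) :
      fderiv ℝ (fun y => fderiv ℝ f y v) x w = fderiv ℝ (fderiv ℝ f) x w v := by
    rw [fderiv_clm_apply hd (differentiableAt_const v)]
    simp
  have hs : IsSymmSndFDerivAt ℝ f x :=
    (hf.contDiffAt (x := x)).isSymmSndFDerivAt
      (by simpa using WithTop.coe_le_coe.2 (le_top (a := (2 : ℕ∞))))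
  unfold pd
  rw [key, key]
  exact hs _ _

theorem pd_congr (k : Fin n) {f h : (Fin n → ℝ) → ℝ} {x : Fin n → ℝ}
    (H : f =ᶠ[nhds x] h) : pd k f x = pd k h x := by
  simp only [pd, H.fderiv_eq]

end PartialDerivatives

section MatrixFields

variable {n : ℕ}

/-- Entrywise smoothness of a matrix field. -/
def SmoothField (M : (Fin n → ℝ) → Matrix (Fin n) (Fin n) ℝ) : Prop :=
  ∀ i j, ContDiff ℝ ∞ fun x => M x i j

/-- Entrywise partial derivative of a matrix field. -/
def matPd (k : Fin n) (M : (Fin n → ℝ) → Matrix (Fin n) (Fin n) ℝ) (x : Fin n → ℝ) :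
    Matrix (Fin n) (Fin n) ℝ :=
  Matrix.of fun i j => pd k (fun y => M y i j) x

variable {M N : (Fin n → ℝ) → Matrix (Fin n) (Fin n) ℝ}

theorem SmoothField.mul (hM : SmoothField M) (hN : SmoothField N) :
    SmoothField fun x => M x * N x := fun i j => by
  simp only [Matrix.mul_apply]
  exact ContDiff.sum fun p _ => (hM i p).mul (hN p j)

theorem SmoothField.add (hM : SmoothField M) (hN : SmoothField N) :
    SmoothField fun x => M x + N x := fun i j => (hM i j).add (hN i j)

theorem SmoothField.transpose (hM : SmoothField M) : SmoothField fun x => (M x)ᵀ :=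
  fun i j => hM j i

theorem matPd_mul (k : Fin n) (hM : SmoothField M) (hN : SmoothField N) (x : Fin n → ℝ) :
    matPd k (fun y => M y * N y) x = matPd k M x * N x + M x * matPd k N x := by
  ext i j
  simp only [matPd, Matrix.of_apply, Matrix.add_apply, Matrix.mul_apply]
  rw [pd_sum k _ fun p => (hM i p).mul (hN p j), ← Finset.sum_add_distrib]
  exact Finset.sum_congr rfl fun p _ => pd_mul k (hM i p) (hN p j) x

theorem matPd_add (k : Fin n) (hM : SmoothField M) (hN : SmoothField N) (x : Fin n → ℝ) :
    matPd k (fun y => M y + N y) x = matPd k M x + matPd k N x := by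
  ext i j
  exact pd_add k (hM i j) (hN i j) x

theorem matPd_transpose (k : Fin n) (x : Fin n → ℝ) :
    matPd k (fun y => (M y)ᵀ) x = (matPd k M x)ᵀ := rfl

theorem matPd_comm (k l : Fin n) (hM : SmoothField M) (x : Fin n → ℝ) :
    matPd l (matPd k M) x = matPd k (matPd l M) x := by
  ext i j
  exact pd_comm k l (hM i j) x

/-- Curvature of the family of matrix fields `G`. -/
def curv (G : Fin n → (Fin n → ℝ) → Matrix (Fin n) (Fin n) ℝ) (k l : Fin n)
    (x : Fin n → ℝ) : Matrix (Fin n) (Fin n) ℝ :=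
  matPd k (G l) x - matPd l (G k) x + G l x * G k x - G k x * G l x

variable {G S : Fin n → (Fin n → ℝ) → Matrix (Fin n) (Fin n) ℝ}

/-- Ricci identity for a field of covectors, stored in the columns of `M`. -/
theorem curv_mul (hG : ∀ k, SmoothField (G k)) (hM : SmoothField M)
    (hS : ∀ k, SmoothField (S k))
    (h : ∀ k x, matPd k M x = G k x * M x + S k x) (k l : Fin n) (x : Fin n → ℝ) :
    curv G k l x * M x =
      (matPd l (S k) x - G l x * S k x) - (matPd k (S l) x - G k x * S l x) := by
  have second (k l : Fin n) : matPd l (matPd k M) x =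
      matPd l (G k) x * M x + G k x * (G l x * M x + S l x) + matPd l (S k) x := by
    rw [show matPd k M = fun y => G k y * M y + S k y from funext (h k),
      matPd_add l ((hG k).mul hM) (hS k), matPd_mul l (hG k) hM, h l]
  have hc := matPd_comm k l hM x
  rw [second k l, second l k] at hc
  rw [← sub_eq_zero] at hc ⊢
  rw [← neg_eq_zero, ← hc, curv]
  noncomm_ring

/-- Ricci identity for a field of bilinear forms. -/
theorem curv_mul_add_mul_transpose (hG : ∀ k, SmoothField (G k)) (hM : SmoothField M)
    (hS : ∀ k, SmoothField (S k))
    (h : ∀ k x, matPd k M x = G k x * M x + M x * (G k x)ᵀ + S k x)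
    (k l : Fin n) (x : Fin n → ℝ) :
    curv G k l x * M x + M x * (curv G k l x)ᵀ =
      (matPd l (S k) x - G l x * S k x - S k x * (G l x)ᵀ)
        - (matPd k (S l) x - G k x * S l x - S l x * (G k x)ᵀ) := by
  have second (k l : Fin n) : matPd l (matPd k M) x =
      matPd l (G k) x * M x + G k x * (G l x * M x + M x * (G l x)ᵀ + S l x)
        + ((G l x * M x + M x * (G l x)ᵀ + S l x) * (G k x)ᵀ + M x * (matPd l (G k) x)ᵀ)
        + matPd l (S k) x := by
    rw [show matPd k M = fun y => G k y * M y + M y * (G k y)ᵀ + S k y from funext (h k),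
      matPd_add l (((hG k).mul hM).add (hM.mul (hG k).transpose)) (hS k),
      matPd_add l ((hG k).mul hM) (hM.mul (hG k).transpose), matPd_mul l (hG k) hM,
      matPd_mul l hM (hG k).transpose, h l, matPd_transpose]
  have hc := matPd_comm k l hM x
  rw [second k l, second l k] at hc
  rw [← sub_eq_zero] at hc ⊢
  rw [← neg_eq_zero, ← hc, curv]
  simp only [Matrix.transpose_sub, Matrix.transpose_add, Matrix.transpose_mul]
  noncomm_ring

theorem curv_swap (k l : Fin n) (x : Fin n → ℝ) : curv G k l x = -curv G l k x := by
  simp only [curv]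
  abel

/-- First Bianchi identity. -/
theorem curv_cyclic (hG : ∀ x i j p, G i x j p = G j x i p) (x : Fin n → ℝ)
    (i k l q : Fin n) :
    curv G k l x i q + curv G l i x k q + curv G i k x l q = 0 := by
  have e1 (a b c : Fin n) : matPd a (G b) x c q = matPd a (G c) x b q := by
    simp only [matPd, Matrix.of_apply, fun y => hG y b c q]
  have e2 (a b c : Fin n) : (G a x * G b x) c q = (G c x * G b x) a q := by
    simp only [Matrix.mul_apply, fun p => hG x a c p]
  simp only [curv, Matrix.sub_apply, Matrix.add_apply]
  rw [e1 k l i, e1 l k i, e1 i l k, e2 l k i, e2 k l i, e2 l i k]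
  ring

end MatrixFields

/-- Pair symmetry of an algebraic curvature tensor. -/
theorem curvature_pair_symm {ι : Type*} {r : ι → ι → ι → ι → ℝ}
    (h1 : ∀ i j k l, r i j k l = -r j i k l) (h2 : ∀ i j k l, r i j k l = -r i j l k)
    (hb : ∀ i j k l, r i j k l + r k j l i + r l j i k = 0) (i j k l : ι) :
    r i j k l = r k l i j := by
  linarith [hb l i j k, hb l j i k, h1 k j l i, h2 l j i k, h1 l i j k, h1 j i k l, h1 l k i j,
    h1 l j k i, hb k l i j, hb l k i j, h2 k i j l, h1 k i j l]

section PointwiseAlgebra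

variable {n : ℕ} {g h A : Matrix (Fin n) (Fin n) ℝ}

theorem contracted_integrability_s16 {R : Fin n → Fin n → Matrix (Fin n) (Fin n) ℝ}
    {u σ : Fin n → ℝ} {B : ℝ} (hg : gᵀ = g) (hgh : g * h = 1) (hA : Aᵀ = A)
    (hswap : ∀ k l, R k l = -R l k)
    (hcyc : ∀ i k l q, R k l i q + R l i k q + R i k l q = 0)
    (hRg : ∀ k l, R k l * g + g * (R k l)ᵀ = 0)
    (hRu : ∀ k l i, (R k l *ᵥ u) i = σ l * g i k - σ k * g i l)
    (hRA : ∀ k l i j, (R k l * A + A * (R k l)ᵀ) i j =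
      B * (A i l * g j k + g i k * A j l - A i k * g j l - g i l * A j k))
    (i j k : Fin n) :
    g i k * ((σ - B • u) ᵥ* (h * A)) j + g j k * ((σ - B • u) ᵥ* (h * A)) i =
      (σ - B • u) i * A k j + (σ - B • u) j * A k i := by
  have gsymm (i j : Fin n) : g i j = g j i := congrFun₂ hg j i
  have asymm (i j : Fin n) : A i j = A j i := congrFun₂ hA j i
  have hgL : g * (h * A) = A := by rw [← Matrix.mul_assoc, hgh, Matrix.one_mul]
  set w : Fin n → ℝ := h *ᵥ u with hw
  have hgw : g *ᵥ w = u := by rw [hw, Matrix.mulVec_mulVec, hgh, Matrix.one_mulVec]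
  have hht : hᵀ = h := by
    have e : hᵀ * g = 1 := by
      have := congrArg Matrix.transpose hgh
      rwa [Matrix.transpose_mul, hg, Matrix.transpose_one] at this
    calc hᵀ = hᵀ * (g * h) := by rw [hgh, Matrix.mul_one]
      _ = h := by rw [← Matrix.mul_assoc, e, Matrix.one_mul]
  have pair (i j k l : Fin n) : (R k l * g) i j = (R i j * g) k l := by
    refine curvature_pair_symm (r := fun i j k l => (R k l * g) i j) ?_ ?_ ?_ i j k l
    · intro i j k l
      have e : g * (R k l)ᵀ = (R k l * g)ᵀ := by rw [Matrix.transpose_mul, hg]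
      exact eq_neg_of_add_eq_zero_left (congrFun₂ (e ▸ hRg k l) i j)
    · intro i j k l
      rw [hswap k l, Matrix.neg_mul, Matrix.neg_apply]
    · intro i j k l
      simp only [Matrix.mul_apply, ← Finset.sum_add_distrib, ← add_mul, hcyc, zero_mul,
        Finset.sum_const_zero]
  have ric (i j k : Fin n) : ∑ l, w l * (R k l * g) i j = σ j * g k i - σ i * g k j := by
    rw [← hRu i j k, ← hgw, Matrix.mulVec_mulVec]
    simp only [Matrix.mulVec, dotProduct, pair i j k, mul_comm]
  have left (i j k : Fin n) :
      ∑ l, w l * (R k l * A) i j = g k i * (σ ᵥ* (h * A)) j - σ i * A k j := by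
    have e1 (l : Fin n) : (R k l * A) i j = ∑ p, (R k l * g) i p * (h * A) p j := by
      rw [← Matrix.mul_apply, Matrix.mul_assoc, hgL]
    calc ∑ l, w l * (R k l * A) i j
        = ∑ p, (∑ l, w l * (R k l * g) i p) * (h * A) p j := by
          simp only [e1, Finset.mul_sum, Finset.sum_mul, mul_assoc]
          exact Finset.sum_comm
      _ = g k i * ∑ p, σ p * (h * A) p j - σ i * ∑ p, g k p * (h * A) p j := by
          simp only [ric, Finset.mul_sum, ← Finset.sum_sub_distrib]
          exact Finset.sum_congr rfl fun p _ => by ring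
      _ = _ := by
          rw [← Matrix.mul_apply, hgL]
          rfl
  have aw (i : Fin n) : ∑ l, w l * A i l = (u ᵥ* (h * A)) i := by
    have : u ᵥ* (h * A) = A *ᵥ w := by
      rw [hw, Matrix.mulVec_mulVec, ← Matrix.mulVec_transpose, Matrix.transpose_mul, hA, hht]
    rw [this]
    simp only [Matrix.mulVec, dotProduct, mul_comm]
  have gw (i : Fin n) : ∑ l, w l * g i l = u i := by
    rw [← hgw]
    simp only [Matrix.mulVec, dotProduct, mul_comm]
  have total : ∑ l, w l * (R k l * A + A * (R k l)ᵀ) i j =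
      B * ((u ᵥ* (h * A)) i * g j k + g i k * (u ᵥ* (h * A)) j - A i k * u j - u i * A j k) := by
    simp only [hRA, ← aw, ← gw, Finset.sum_mul, Finset.mul_sum, ← Finset.sum_add_distrib,
      ← Finset.sum_sub_distrib]
    exact Finset.sum_congr rfl fun p _ => by ring
  have split (l : Fin n) :
      (R k l * A + A * (R k l)ᵀ) i j = (R k l * A) i j + (R k l * A) j i := by
    have e : A * (R k l)ᵀ = (R k l * A)ᵀ := by rw [Matrix.transpose_mul, hA]
    rw [e, Matrix.add_apply, Matrix.transpose_apply]
  simp only [split, mul_add, Finset.sum_add_distrib, left] at total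
  simp only [Matrix.sub_vecMul, Matrix.smul_vecMul, Pi.sub_apply, Pi.smul_apply, smul_eq_mul]
  rw [gsymm k i, gsymm k j] at total
  rw [asymm i k, asymm j k] at total
  linarith

theorem eq_zero_or_eq_trace_smul {τ : Fin n → ℝ} (hn : n ≠ 0) (hg : gᵀ = g) (hgh : g * h = 1)
    (hτ : ∀ i j k, g i k * (τ ᵥ* (h * A)) j + g j k * (τ ᵥ* (h * A)) i =
      τ i * A k j + τ j * A k i) :
    τ = 0 ∨ A = ((h * A).trace / n) • g := by
  have hn' : (n : ℝ) ≠ 0 := by exact_mod_cast hn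
  have gsymm (i j : Fin n) : g i j = g j i := congrFun₂ hg j i
  have hhg : h * g = 1 := mul_eq_one_comm.1 hgh
  set v := τ ᵥ* (h * A) with hv
  have contr (j : Fin n) : n * v j = (h * A).trace * τ j := by
    have s : ∑ i, ∑ k, h i k * (g i k * v j + g j k * v i)
        = ∑ i, ∑ k, h i k * (τ i * A k j + τ j * A k i) := by simp only [hτ]
    have s1 : ∑ i, ∑ k, h i k * (g i k * v j + g j k * v i) = n * v j + v j := by
      have t (i m : Fin n) : ∑ k, h i k * g k m = if i = m then 1 else 0 := by
        rw [← Matrix.mul_apply, hhg, Matrix.one_apply]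
      have (i : Fin n) : ∑ k, h i k * (g i k * v j + g j k * v i) =
          (∑ k, h i k * g k i) * v j + (∑ k, h i k * g k j) * v i := by
        simp only [Finset.sum_mul, ← Finset.sum_add_distrib]
        exact Finset.sum_congr rfl fun k _ => by rw [gsymm i k, gsymm j k]; ring
      simp [this, t, Finset.sum_add_distrib]
    have s2 : ∑ i, ∑ k, h i k * (τ i * A k j + τ j * A k i) = v j + (h * A).trace * τ j := by
      simp only [hv, Matrix.vecMul, dotProduct, Matrix.trace, Matrix.diag, Matrix.mul_apply,
        Finset.sum_mul, Finset.mul_sum, ← Finset.sum_add_distrib]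
      exact Finset.sum_congr rfl fun i _ => Finset.sum_congr rfl fun k _ => by ring
    linarith
  set f := (h * A).trace / n with hf
  have hvf (j : Fin n) : v j = f * τ j := by
    rw [hf]
    field_simp
    linarith [contr j]
  have hb (i j k : Fin n) : τ i * (A k j - f * g k j) + τ j * (A k i - f * g k i) = 0 := by
    have := hτ i j k
    rw [hvf, hvf, gsymm i k, gsymm j k] at this
    linarith
  refine or_iff_not_imp_left.2 fun h0 => ?_
  obtain ⟨i, hi⟩ : ∃ i, τ i ≠ 0 := by
    by_contra! h'
    exact h0 (funext h')
  have h1 (k : Fin n) : A k i - f * g k i = 0 := by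
    have := hb i i k
    rw [← two_mul, mul_eq_zero, mul_eq_zero] at this
    simpa [hi] using this
  ext k j
  have := hb i j k
  rw [h1 k, mul_zero, add_zero, mul_eq_zero] at this
  simpa [hi, sub_eq_zero] using this

/-- The Sinjukov right-hand side is pure trace only for the zero covector. -/
theorem eq_zero_of_sinjukov_eq_smul {u : Fin n → ℝ} (hn : 2 ≤ n) (hg : gᵀ = g)
    (hgh : g * h = 1)
    (hu : ∀ i j k, u i * g j k + u j * g i k = 2 / n * u k * g i j) : u = 0 := by
  have hn' : (2 : ℝ) ≤ n := by exact_mod_cast hn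
  have gsymm (i j : Fin n) : g i j = g j i := congrFun₂ hg j i
  have t (i m : Fin n) : ∑ k, g i k * h k m = if i = m then 1 else 0 := by
    rw [← Matrix.mul_apply, hgh, Matrix.one_apply]
  funext i
  have s : ∑ j, ∑ k, (u i * g j k + u j * g i k) * h k j
      = ∑ j, ∑ k, (2 / n * u k * g i j) * h k j := by simp only [hu]
  have s1 : ∑ j, ∑ k, (u i * g j k + u j * g i k) * h k j = n * u i + u i := by
    simp [add_mul, mul_assoc, Finset.sum_add_distrib, ← Finset.mul_sum, t]
  have s2 : ∑ j, ∑ k, (2 / n * u k * g i j) * h k j = 2 / n * u i := by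
    have t' (i m : Fin n) : ∑ j, h m j * g i j = if m = i then 1 else 0 := by
      simp only [gsymm i]
      rw [← Matrix.mul_apply, mul_eq_one_comm.1 hgh, Matrix.one_apply]
    rw [Finset.sum_comm]
    simp only [mul_assoc, mul_comm (g i _), ← Finset.mul_sum, t']
    simp
  have h2 : (n + 1 - 2 / n : ℝ) * u i = 0 := by linarith
  have h3 : (2 / n : ℝ) ≤ 1 := (div_le_one (by linarith)).2 hn'
  exact (mul_eq_zero.1 h2).resolve_left (by linarith)

end PointwiseAlgebra

section LeviCivita

variable {n : ℕ} {g ginv a : (Fin n → ℝ) → Fin n → Fin n → ℝ}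

/-- The Levi-Civita connection matrices `(G_k)_{ip} = Γ^p_{ik}`. -/
def connMat (g ginv : (Fin n → ℝ) → Fin n → Fin n → ℝ) (k : Fin n) (x : Fin n → ℝ) :
    Matrix (Fin n) (Fin n) ℝ :=
  Matrix.of fun i p => christoffel g ginv p i k x

theorem smoothField_connMat (hg : ∀ i j, ContDiff ℝ ∞ fun x => g x i j)
    (hginv : ∀ i j, ContDiff ℝ ∞ fun x => ginv x i j) (k : Fin n) :
    SmoothField (connMat g ginv k) := fun i p => by
  simp only [connMat, christoffel, Matrix.of_apply]
  exact contDiff_const.mul <| ContDiff.sum fun l _ => (hginv p l).mul <|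
    (((hg l k).pd i).add ((hg l i).pd k)).sub ((hg i k).pd l)

theorem connMat_symm (hg : ∀ x i j, g x i j = g x j i) (x : Fin n → ℝ) (i j p : Fin n) :
    connMat g ginv i x j p = connMat g ginv j x i p := by
  simp only [connMat, christoffel, Matrix.of_apply, fun y => hg y j i]
  congr 1
  exact Finset.sum_congr rfl fun l _ => by ring

theorem covD2_eq_matPd (i j k : Fin n) (x : Fin n → ℝ) :
    covD2 g ginv a i j k x =
      (matPd k (fun y => Matrix.of (a y)) x - connMat g ginv k x * Matrix.of (a x)
        - Matrix.of (a x) * (connMat g ginv k x)ᵀ) i j := by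
  simp only [covD2, matPd, connMat, Matrix.sub_apply, Matrix.mul_apply, Matrix.of_apply,
    Matrix.transpose_apply, mul_comm (a x i _)]

/-- The Levi-Civita connection is metric. -/
theorem covD2_metric (hg : ∀ x i j, g x i j = g x j i)
    (hinv : ∀ x i j, (∑ k, g x i k * ginv x k j) = if i = j then (1 : ℝ) else 0)
    (i j k : Fin n) (x : Fin n → ℝ) : covD2 g ginv g i j k x = 0 := by
  have lower (i j : Fin n) : ∑ p, christoffel g ginv p i k x * g x p j =
      1 / 2 * (pd i (fun y => g y j k) x + pd k (fun y => g y j i) x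
        - pd j (fun y => g y i k) x) := by
    set c : Fin n → ℝ := fun l => pd i (fun y => g y l k) x + pd k (fun y => g y l i) x
        - pd l (fun y => g y i k) x with hc
    calc ∑ p, christoffel g ginv p i k x * g x p j
        = 1 / 2 * ∑ l, (∑ p, g x j p * ginv x p l) * c l := by
          simp only [christoffel, Finset.mul_sum, Finset.sum_mul]
          rw [Finset.sum_comm]
          exact Finset.sum_congr rfl fun l _ => Finset.sum_congr rfl fun p _ => by
            rw [hg x p j, hc]; ring
      _ = _ := by simp [hinv, hc]
  have lower' : ∑ p, christoffel g ginv p j k x * g x i p =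
      ∑ p, christoffel g ginv p j k x * g x p i := by simp only [fun p => hg x i p]
  rw [covD2, lower', lower, lower]
  simp only [fun y => hg y j i]
  ring

theorem pd_eq_of_covD2 {i j k : Fin n} {x : Fin n → ℝ} {s : ℝ}
    (h : covD2 g ginv a i j k x = s) :
    pd k (fun y => a y i j) x = (∑ p, connMat g ginv k x i p * a x p j)
      + (∑ p, connMat g ginv k x j p * a x i p) + s := by
  simp only [← h, covD2, connMat, Matrix.of_apply]
  ring

theorem matPd_eq_of_covD2 {s : Fin n → (Fin n → ℝ) → Matrix (Fin n) (Fin n) ℝ}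
    (h : ∀ x i j k, covD2 g ginv a i j k x = s k x i j) (k : Fin n) (x : Fin n → ℝ) :
    matPd k (fun y => Matrix.of (a y)) x = connMat g ginv k x * Matrix.of (a x)
      + Matrix.of (a x) * (connMat g ginv k x)ᵀ + s k x := by
  ext i j
  have := h x i j k
  rw [covD2_eq_matPd] at this
  simp only [Matrix.add_apply, Matrix.sub_apply] at this ⊢
  linarith

theorem pd_pd_eq_of_hess {f : (Fin n → ℝ) → ℝ} {i j : Fin n} {x : Fin n → ℝ} {s : ℝ}
    (h : hess g ginv f i j x = s) :
    pd j (fun y => pd i f y) x = (∑ p, connMat g ginv j x i p * pd p f x) + s := by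
  simp only [← h, hess, covD1, connMat, Matrix.of_apply]
  ring

variable {μ lam : (Fin n → ℝ) → ℝ} {B : ℝ}

/-- Integrability condition of the Hessian equation. -/
theorem curv_mulVec_grad
    (hgC : ∀ i j, ContDiff ℝ ∞ fun x => g x i j)
    (hginvC : ∀ i j, ContDiff ℝ ∞ fun x => ginv x i j)
    (haC : ∀ i j, ContDiff ℝ ∞ fun x => a x i j)
    (hμC : ContDiff ℝ ∞ μ) (hlamC : ContDiff ℝ ∞ lam)
    (hgsym : ∀ x i j, g x i j = g x j i)
    (hinv : ∀ x i j, (∑ k, g x i k * ginv x k j) = if i = j then (1 : ℝ) else 0)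
    (ha : ∀ x i j k, covD2 g ginv a i j k x
      = pd i lam x * g x j k + pd j lam x * g x i k)
    (hhess : ∀ x i j, hess g ginv lam i j x = μ x * g x i j + B * a x i j)
    (x : Fin n → ℝ) (k l i : Fin n) :
    (curv (connMat g ginv) k l x *ᵥ fun p => pd p lam x) i =
      (pd l μ x - B * pd l lam x) * g x i k - (pd k μ x - B * pd k lam x) * g x i l := by
  set U : (Fin n → ℝ) → Matrix (Fin n) (Fin n) ℝ := fun y => Matrix.of fun p _ => pd p lam y
    with hU
  set H : Fin n → (Fin n → ℝ) → Matrix (Fin n) (Fin n) ℝ :=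
    fun k y => Matrix.of fun p _ => μ y * g y p k + B * a y p k with hH
  have key := curv_mul (G := connMat g ginv) (M := U) (S := H)
    (smoothField_connMat hgC hginvC) (fun p _ => hlamC.pd p)
    (fun k p _ => (hμC.mul (hgC p k)).add (contDiff_const.mul (haC p k)))
    (fun k x => by
      ext p q
      simpa [matPd, hU, hH, Matrix.mul_apply] using pd_pd_eq_of_hess (hhess x p k)) k l x
  have entry (k l : Fin n) : (matPd l (H k) x - connMat g ginv l x * H k x) i i =
      pd l μ x * g x i k + B * (pd i lam x * g x k l + pd k lam x * g x i l)
        + ∑ p, connMat g ginv l x k p * (μ x * g x i p + B * a x i p) := by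
    simp only [matPd, hH, Matrix.sub_apply, Matrix.mul_apply, Matrix.of_apply]
    rw [pd_add l (hμC.mul (hgC i k)) (contDiff_const.mul (haC i k)), pd_mul l hμC (hgC i k),
      pd_const_mul l B (haC i k), pd_eq_of_covD2 (ha x i k l),
      pd_eq_of_covD2 (covD2_metric hgsym hinv i k l x)]
    simp only [mul_add, Finset.sum_add_distrib, Finset.mul_sum, mul_left_comm _ (μ x),
      mul_left_comm _ B]
    ring
  have symm (p : Fin n) : connMat g ginv l x k p = connMat g ginv k x l p :=
    connMat_symm hgsym x l k p
  have := congrFun₂ key i i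
  rw [Matrix.sub_apply _ (matPd k (H l) x - _), entry, entry] at this
  simp only [symm, hgsym x k l] at this
  refine Eq.trans ?_ (this.trans (by ring))
  rfl

/-- Integrability condition of the Sinjukov equation. -/
theorem curv_mul_sinjukov
    (hgC : ∀ i j, ContDiff ℝ ∞ fun x => g x i j)
    (hginvC : ∀ i j, ContDiff ℝ ∞ fun x => ginv x i j)
    (haC : ∀ i j, ContDiff ℝ ∞ fun x => a x i j) (hlamC : ContDiff ℝ ∞ lam)
    (hgsym : ∀ x i j, g x i j = g x j i)
    (hinv : ∀ x i j, (∑ k, g x i k * ginv x k j) = if i = j then (1 : ℝ) else 0)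
    (ha : ∀ x i j k, covD2 g ginv a i j k x
      = pd i lam x * g x j k + pd j lam x * g x i k)
    (hhess : ∀ x i j, hess g ginv lam i j x = μ x * g x i j + B * a x i j)
    (x : Fin n → ℝ) (k l i j : Fin n) :
    (curv (connMat g ginv) k l x * Matrix.of (a x)
        + Matrix.of (a x) * (curv (connMat g ginv) k l x)ᵀ) i j =
      B * (a x i l * g x j k + g x i k * a x j l - a x i k * g x j l - g x i l * a x j k) := by
  set S : Fin n → (Fin n → ℝ) → Matrix (Fin n) (Fin n) ℝ :=
    fun k y => Matrix.of fun i j => pd i lam y * g y j k + pd j lam y * g y i k with hS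
  have key := curv_mul_add_mul_transpose (G := connMat g ginv)
    (M := fun y => Matrix.of (a y)) (S := S) (smoothField_connMat hgC hginvC) haC
    (fun k i j => ((hlamC.pd i).mul (hgC j k)).add ((hlamC.pd j).mul (hgC i k)))
    (matPd_eq_of_covD2 ha) k l x
  have entry (k l : Fin n) :
      (matPd l (S k) x - connMat g ginv l x * S k x - S k x * (connMat g ginv l x)ᵀ) i j =
      (μ x * g x i l + B * a x i l) * g x j k + (μ x * g x j l + B * a x j l) * g x i k
        + ∑ p, connMat g ginv l x k p * (pd i lam x * g x j p + pd j lam x * g x i p) := by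
    simp only [matPd, hS, Matrix.sub_apply, Matrix.mul_apply, Matrix.of_apply,
      Matrix.transpose_apply]
    rw [pd_add l ((hlamC.pd i).mul (hgC j k)) ((hlamC.pd j).mul (hgC i k)),
      pd_mul l (hlamC.pd i) (hgC j k), pd_mul l (hlamC.pd j) (hgC i k),
      pd_eq_of_covD2 (covD2_metric hgsym hinv i k l x),
      pd_eq_of_covD2 (covD2_metric hgsym hinv j k l x),
      pd_pd_eq_of_hess (hhess x i l), pd_pd_eq_of_hess (hhess x j l)]
    simp only [mul_add, add_mul, Finset.sum_add_distrib, Finset.mul_sum, Finset.sum_mul]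
    simp only [mul_comm, mul_left_comm]
    ring
  have symm (p : Fin n) : connMat g ginv l x k p = connMat g ginv k x l p :=
    connMat_symm hgsym x l k p
  rw [key, Matrix.sub_apply _ (matPd k (S l) x - _ - _), entry, entry]
  simp only [symm]
  ring

/-- The Sinjukov and Hessian equations force `μ_{,i} = 2 B λ_i`. -/
theorem pd_mu_eq (hn : 2 ≤ n)
    (hgC : ∀ i j, ContDiff ℝ ∞ fun x => g x i j)
    (hginvC : ∀ i j, ContDiff ℝ ∞ fun x => ginv x i j)
    (haC : ∀ i j, ContDiff ℝ ∞ fun x => a x i j)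
    (hμC : ContDiff ℝ ∞ μ)
    (hgsym : ∀ x i j, g x i j = g x j i)
    (hinv : ∀ x i j, (∑ k, g x i k * ginv x k j) = if i = j then (1 : ℝ) else 0)
    (hasym : ∀ x i j, a x i j = a x j i)
    (hlam : ∀ x, lam x = (1 / 2) * ∑ p, ∑ q, ginv x p q * a x p q)
    (ha : ∀ x i j k, covD2 g ginv a i j k x
      = pd i lam x * g x j k + pd j lam x * g x i k)
    (hhess : ∀ x i j, hess g ginv lam i j x = μ x * g x i j + B * a x i j)
    (x : Fin n → ℝ) (k : Fin n) : pd k μ x = 2 * B * pd k lam x := by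
  have hlamC : ContDiff ℝ ∞ lam := by
    rw [funext hlam]
    exact contDiff_const.mul <| ContDiff.sum fun p _ => ContDiff.sum fun q _ =>
      (hginvC p q).mul (haC p q)
  have hgt (y) : (Matrix.of (g y))ᵀ = Matrix.of (g y) := Matrix.ext fun i j => hgsym y j i
  have hat (y) : (Matrix.of (a y))ᵀ = Matrix.of (a y) := Matrix.ext fun i j => hasym y j i
  have hgh (y) : Matrix.of (g y) * Matrix.of (ginv y) = 1 := by
    ext i j
    simp [Matrix.mul_apply, hinv, Matrix.one_apply]
  have htr (y) : (Matrix.of (ginv y) * Matrix.of (a y)).trace = 2 * lam y := by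
    simp [Matrix.trace, Matrix.mul_apply, hlam, fun p q => hasym y p q]
  have metric := matPd_eq_of_covD2 (s := fun _ _ => 0)
    fun x i j k => covD2_metric hgsym hinv i j k x
  set τ : (Fin n → ℝ) → Fin n → ℝ := fun y =>
    (fun p => pd p μ y - B * pd p lam y) - B • fun p => pd p lam y with hτ
  have alt (y) : τ y = 0 ∨ ∀ i j, a y i j = 2 / n * lam y * g y i j := by
    have := eq_zero_or_eq_trace_smul (by omega) (hgt y) (hgh y)
      (contracted_integrability_s16 (hgt y) (hgh y) (hat y) (fun k l => curv_swap k l y)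
        (curv_cyclic (connMat_symm hgsym) y)
        (fun k l => by
          have := curv_mul_add_mul_transpose (M := fun y => Matrix.of (g y))
            (S := fun _ _ => 0) (smoothField_connMat hgC hginvC) hgC
            (fun _ _ _ => contDiff_const) metric k l y
          rw [this]
          ext i j
          simp [matPd, pd])
        (curv_mulVec_grad hgC hginvC haC hμC hlamC hgsym hinv ha hhess y)
        (curv_mul_sinjukov hgC hginvC haC hlamC hgsym hinv ha hhess y))
    refine this.imp id fun h i j => ?_
    have := congrFun₂ h i j
    rw [htr] at this
    simp only [Matrix.of_apply, Matrix.smul_apply, smul_eq_mul] at this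
    rw [this]
    ring
  suffices τ x = 0 by
    have := congrFun this k
    simp only [hτ, Pi.sub_apply, Pi.smul_apply, smul_eq_mul, Pi.zero_apply] at this
    linarith
  by_contra hx
  have hτC : Continuous τ := continuous_pi fun p =>
    (((hμC.pd p).continuous.sub (continuous_const.mul (hlamC.pd p).continuous)).sub
      (continuous_const.mul (hlamC.pd p).continuous))
  have near : ∀ᶠ y in nhds x, ∀ i j, a y i j = 2 / n * lam y * g y i j :=
    (hτC.continuousAt.eventually_ne hx).mono fun y hy => (alt y).resolve_left hy
  have fC : ContDiff ℝ ∞ fun y => 2 / n * lam y := contDiff_const.mul hlamC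
  have near_grad : ∀ᶠ y in nhds x, (fun p => pd p lam y) = 0 := by
    filter_upwards [near.eventually_nhds] with y hy
    refine eq_zero_of_sinjukov_eq_smul hn (hgt y) (hgh y) fun i j k => ?_
    have e1 := pd_congr k (hy.mono fun z hz => hz i j)
    rw [pd_mul k fC (hgC i j), pd_const_mul k _ hlamC, pd_eq_of_covD2 (ha y i j k),
      pd_eq_of_covD2 (covD2_metric hgsym hinv i j k y)] at e1
    simp only [hy.self_of_nhds, mul_left_comm _ (2 / (n : ℝ) * lam y), ← Finset.mul_sum] at e1
    simp only [Matrix.of_apply]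
    linarith
  have near_mu : ∀ᶠ y in nhds x, μ y = -B * (2 / n) * lam y := by
    filter_upwards [near, near_grad.eventually_nhds] with y hy hgrad
    have hH (i j : Fin n) : (μ y + B * (2 / n) * lam y) * g y i j = 0 := by
      have e := pd_pd_eq_of_hess (hhess y i j)
      have z (p : Fin n) : pd p lam y = 0 := congrFun hgrad.self_of_nhds p
      rw [pd_congr j (h := fun _ => (0 : ℝ)) (hgrad.mono fun w hw => congrFun hw i), hy i j] at e
      simp only [z, mul_zero, Finset.sum_const_zero] at e
      simp only [pd, fderiv_fun_const, Pi.zero_apply, zero_apply] at e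
      linarith
    have := hinv y k k
    rw [if_pos rfl] at this
    have e : (μ y + B * (2 / n) * lam y) * ∑ p, g y k p * ginv y p k = 0 := by
      simp [Finset.mul_sum, ← mul_assoc, hH]
    rw [this, mul_one] at e
    linarith
  refine hx (funext fun p => ?_)
  have z : pd p lam x = 0 := congrFun near_grad.self_of_nhds p
  have e : pd p μ x = 0 := by rw [pd_congr p near_mu, pd_const_mul p _ hlamC, z, mul_zero]
  simp [hτ, z, e]

end LeviCivita

/-- Corollary 1 of the paper: if `(a, λ)` satisfies the Sinjukov equation
`a_{ij,k} = λ_i g_{jk} + λ_j g_{ik}` and the Hessian equation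
`λ_{,ij} = μ g_{ij} + B a_{ij}` (with `B` constant, `μ` smooth), and `a` is not a
constant multiple of `g`, then `λ` satisfies the Obata–Tanno equation
`λ_{,ijk} − B(2λ_{,k}g_{ij} + λ_{,j}g_{ik} + λ_{,i}g_{jk}) = 0`. -/
theorem stmt_16 {n : ℕ} (hn : 2 ≤ n)
    (g ginv a : (Fin n → ℝ) → Fin n → Fin n → ℝ)
    (μ lam : (Fin n → ℝ) → ℝ) (B : ℝ)
    (hgC : ∀ i j, ContDiff ℝ (⊤ : ℕ∞) (fun x => g x i j))
    (hginvC : ∀ i j, ContDiff ℝ (⊤ : ℕ∞) (fun x => ginv x i j))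
    (haC : ∀ i j, ContDiff ℝ (⊤ : ℕ∞) (fun x => a x i j))
    (hμC : ContDiff ℝ (⊤ : ℕ∞) μ)
    (hgsym : ∀ x i j, g x i j = g x j i)
    (hinv : ∀ x i j, (∑ k, g x i k * ginv x k j) = if i = j then (1:ℝ) else 0)
    (hasym : ∀ x i j, a x i j = a x j i)
    (hlam : ∀ x, lam x = (1/2) * ∑ p, ∑ q, ginv x p q * a x p q)
    (ha : ∀ x i j k, covD2 g ginv a i j k x
      = pd i lam x * g x j k + pd j lam x * g x i k)
    (hhess : ∀ x i j, hess g ginv lam i j x = μ x * g x i j + B * a x i j)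
    (hanc : ¬ ∃ c : ℝ, ∀ x i j, a x i j = c * g x i j) :
    ∀ x i j k, thirdD g ginv lam i j k x
      - B * (2 * pd k lam x * g x i j + pd j lam x * g x i k + pd i lam x * g x j k)
      = 0 := by
  intro x i j k
  have hgk := covD2_metric hgsym hinv i j k x
  have hak := ha x i j k
  have hμ := pd_mu_eq hn hgC hginvC haC hμC hgsym hinv hasym hlam ha hhess x k
  have hsum : thirdD g ginv lam i j k x = pd k μ x * g x i j
      + μ x * covD2 g ginv g i j k x + B * covD2 g ginv a i j k x := by
    simp only [thirdD, covD2, hhess]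
    rw [pd_add k (hμC.mul (hgC i j)) (contDiff_const.mul (haC i j)), pd_mul k hμC (hgC i j),
      pd_const_mul k B (haC i j)]
    simp only [mul_add, Finset.sum_add_distrib, mul_left_comm _ (μ x), mul_left_comm _ B,
      ← Finset.mul_sum]
    ring
  rw [hsum, hgk, hak, hμ]
  ring
end
end
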